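/- Let (X,d,≪,≤,τ) be a finitely τ-measurable Lorentzian pre-length space and let γ ∈ TGeo(X) connect p = γ(0) to q = γ(1). Then the following are equivalent: (i) γ is embeddable, i.e., there exists a timelike family about γ that is continuous at γ; (ii) for all sequences pᵢ → p and qᵢ → q there exists i₀ ∈ ℕ such that for all i ≥ i₀ there exists a geodesic γᵢ ∈ TGeo(X) from pᵢ to qᵢ such that γᵢ → γ with respect to d_Γ. -/

import Mathlib

open Set Filter Topology NNReal ENNReal

noncomputable section

/-- A Lorentzian pre-length space structure on a metric space `X`. -/
structure LorentzianPreLengthSpace (X : Type*) [MetricSpace X] where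
  chron : X → X → Prop
  causal : X → X → Prop
  tau : X → X → ℝ≥0∞
  chron_trans : Transitive chron
  causal_trans : Transitive causal
  causal_refl : Reflexive causal
  chron_imp_causal : ∀ {x y : X}, chron x y → causal x y
  tau_lsc : LowerSemicontinuous fun p : X × X => tau p.1 p.2
  tau_eq_zero : ∀ {x y : X}, ¬ causal x y → tau x y = 0
  chron_iff_pos : ∀ x y : X, chron x y ↔ 0 < tau x y
  rev_triangle : ∀ x y z : X, causal x y → causal y z → tau x y + tau y z ≤ tau x z

variable {X : Type*} [MetricSpace X]

/-- `γ` is not constant on any non-trivial subinterval of `[a,b]`. -/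
def NowhereConstantOn (γ : ℝ → X) (a b : ℝ) : Prop :=
  ∀ s t : ℝ, a ≤ s → s < t → t ≤ b → ∃ u, s ≤ u ∧ u ≤ t ∧ γ u ≠ γ s

/-- A future-directed causal curve on `[a,b]`. -/
def IsCausalCurveOn (L : LorentzianPreLengthSpace X) (γ : ℝ → X) (a b : ℝ) : Prop :=
  (∃ K : ℝ≥0, LipschitzOnWith K γ (Icc a b)) ∧ NowhereConstantOn γ a b ∧
    ∀ s t : ℝ, a ≤ s → s < t → t ≤ b → L.causal (γ s) (γ t)

/-- A future-directed timelike curve on `[a,b]`. -/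
def IsTimelikeCurveOn (L : LorentzianPreLengthSpace X) (γ : ℝ → X) (a b : ℝ) : Prop :=
  (∃ K : ℝ≥0, LipschitzOnWith K γ (Icc a b)) ∧ NowhereConstantOn γ a b ∧
    ∀ s t : ℝ, a ≤ s → s < t → t ≤ b → L.chron (γ s) (γ t)

/-- The `τ`-length of a curve on `[a,b]`: the infimum over partitions
`a = t₀ < t₁ < ⋯ < t_N = b` of `Σᵢ τ(γ(tᵢ), γ(tᵢ₊₁))`. -/
def tauLength (L : LorentzianPreLengthSpace X) (γ : ℝ → X) (a b : ℝ) : ℝ≥0∞ :=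
  sInf { s : ℝ≥0∞ | ∃ (N : ℕ) (t : ℕ → ℝ), 1 ≤ N ∧ t 0 = a ∧ t N = b ∧
    StrictMonoOn t (Set.Iic N) ∧
    s = ∑ i ∈ Finset.range N, L.tau (γ (t i)) (γ (t (i + 1))) }

/-- A maximizer on `[a,b]`. -/
def IsMaximizerOn (L : LorentzianPreLengthSpace X) (γ : ℝ → X) (a b : ℝ) : Prop :=
  tauLength L γ a b = L.tau (γ a) (γ b)

/-- A geodesic on `[a,b]`: a causal curve each of whose points has a relative
neighborhood `[a',b'] ⊆ [a,b]` on which the curve is maximizing. -/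
def IsGeodesicOn (L : LorentzianPreLengthSpace X) (γ : ℝ → X) (a b : ℝ) : Prop :=
  IsCausalCurveOn L γ a b ∧
    ∀ t : ℝ, a ≤ t → t ≤ b → ∃ a' b' : ℝ, a ≤ a' ∧ a' ≤ t ∧ t ≤ b' ∧ b' ≤ b ∧
      (a' < t ∨ t = a) ∧ (t < b' ∨ t = b) ∧ IsMaximizerOn L γ a' b'

/-- Every causal curve has finite `τ`-length. -/
def FinitelyTauMeasurable (L : LorentzianPreLengthSpace X) : Prop :=
  ∀ (γ : ℝ → X) (a b : ℝ), a < b → IsCausalCurveOn L γ a b → tauLength L γ a b < ⊤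

/-- A parametrization: a continuous, strictly increasing, surjective self-map of `[0,1]`. -/
def IsParam (φ : ℝ → ℝ) : Prop :=
  ContinuousOn φ (Icc 0 1) ∧ StrictMonoOn φ (Icc 0 1) ∧ φ '' Icc 0 1 = Icc 0 1

/-- Two paths are equivalent if one is a reparametrization of the other. -/
def PathEquiv (γ σ : ℝ → X) : Prop :=
  ∃ φ : ℝ → ℝ, IsParam φ ∧ ∀ t ∈ Icc (0:ℝ) 1, γ t = σ (φ t)

/-- The Fréchet distance of two paths `[0,1] → X`. -/
def frechetDist (γ σ : ℝ → X) : ℝ :=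
  sInf { r : ℝ | ∃ φ ψ : ℝ → ℝ, IsParam φ ∧ IsParam ψ ∧
    ∀ t ∈ Icc (0:ℝ) 1, dist (γ (φ t)) (σ (ψ t)) ≤ r }

/-- The metric `d_Γ` combining Fréchet distance and `τ`-length difference. -/
def dGamma (L : LorentzianPreLengthSpace X) (γ σ : ℝ → X) : ℝ :=
  frechetDist γ σ + |(tauLength L γ 0 1).toReal - (tauLength L σ 0 1).toReal|

/-- `γ` (parametrized on `[0,1]`) represents an element of `TGeo(X)`. -/
def InTGeo (L : LorentzianPreLengthSpace X) (γ : ℝ → X) : Prop :=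
  IsTimelikeCurveOn L γ 0 1 ∧ IsGeodesicOn L γ 0 1


/-- Convergence of a sequence of paths with respect to the metric `d_Γ`. -/
def DGammaTendsto (L : LorentzianPreLengthSpace X) (γs : ℕ → ℝ → X) (γ : ℝ → X) : Prop :=
  Tendsto (fun i => dGamma L (γs i) γ) atTop (𝓝 0)

/-- `p` and `q` are symmetrically conjugate along `γ ∈ TGeo(X)`: there are `pᵢ → p`,
`qᵢ → q` and, for each `i`, two distinct timelike geodesics from `pᵢ` to `qᵢ`, both
converging to `γ` with respect to `d_Γ`. -/
def SymmConjugate (L : LorentzianPreLengthSpace X) (γ : ℝ → X) (p q : X) : Prop :=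
  ∃ (ps qs : ℕ → X) (γs σs : ℕ → ℝ → X),
    Tendsto ps atTop (𝓝 p) ∧ Tendsto qs atTop (𝓝 q) ∧
    (∀ i, InTGeo L (γs i) ∧ InTGeo L (σs i) ∧
      γs i 0 = ps i ∧ γs i 1 = qs i ∧ σs i 0 = ps i ∧ σs i 1 = qs i ∧
      ¬ PathEquiv (γs i) (σs i)) ∧
    DGammaTendsto L γs γ ∧ DGammaTendsto L σs γ

/-- `F` is a timelike family about `γ` on `U × V`. -/
def IsTimelikeFamily (L : LorentzianPreLengthSpace X) (γ : ℝ → X) (U V : Set X)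
    (F : X → X → ℝ → X) : Prop :=
  U ∈ 𝓝 (γ 0) ∧ V ∈ 𝓝 (γ 1) ∧
  (∀ p' ∈ U, ∀ q' ∈ V, L.chron p' q') ∧
  (∀ p' ∈ U, ∀ q' ∈ V, InTGeo L (F p' q') ∧ F p' q' 0 = p' ∧ F p' q' 1 = q') ∧
  PathEquiv (F (γ 0) (γ 1)) γ

/-- The family `F` is continuous (with respect to `d_Γ`) at `γ`, i.e. at `(γ 0, γ 1)`. -/
def FamilyContinuousAt (L : LorentzianPreLengthSpace X) (γ : ℝ → X) (U V : Set X)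
    (F : X → X → ℝ → X) : Prop :=
  ∀ ε > (0:ℝ), ∃ δ > (0:ℝ), ∀ p' ∈ U, ∀ q' ∈ V,
    dist p' (γ 0) < δ → dist q' (γ 1) < δ → dGamma L (F p' q') γ < ε

/-- The family `F` is continuous (with respect to `d_Γ`) about `γ`, i.e. on all of `U × V`. -/
def FamilyContinuousAbout (L : LorentzianPreLengthSpace X) (γ : ℝ → X) (U V : Set X)
    (F : X → X → ℝ → X) : Prop :=
  ∀ p ∈ U, ∀ q ∈ V, ∀ ε > (0:ℝ), ∃ δ > (0:ℝ), ∀ p' ∈ U, ∀ q' ∈ V,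
    dist p' p < δ → dist q' q < δ → dGamma L (F p' q') (F p q) < ε

/-- Two timelike families (defined on `U × V` resp. `U' × V'`) coincide, as maps into
`TGeo(X)`, on a product of neighborhoods `U'' × V''` of `(p, q)` inside the common domain. -/
def FamiliesAgreeNear (p q : X) (U V U' V' : Set X) (F F' : X → X → ℝ → X) : Prop :=
  ∃ U'' ∈ 𝓝 p, ∃ V'' ∈ 𝓝 q, U'' ⊆ U ∩ U' ∧ V'' ⊆ V ∩ V' ∧
    ∀ x ∈ U'', ∀ y ∈ V'', PathEquiv (F x y) (F' x y)

/-- There is a unique (germ of a) timelike family about `γ` that is continuous at `γ`. -/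
def UniqueContFamilyAt (L : LorentzianPreLengthSpace X) (γ : ℝ → X) : Prop :=
  (∃ U V F, IsTimelikeFamily L γ U V F ∧ FamilyContinuousAt L γ U V F) ∧
  (∀ U V F U' V' F', IsTimelikeFamily L γ U V F → FamilyContinuousAt L γ U V F →
    IsTimelikeFamily L γ U' V' F' → FamilyContinuousAt L γ U' V' F' →
    FamiliesAgreeNear (γ 0) (γ 1) U V U' V' F F')

/-- `γ` is embeddable: there is a timelike family about `γ` that is continuous at `γ`. -/
def Embeddable (L : LorentzianPreLengthSpace X) (γ : ℝ → X) : Prop :=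
  ∃ U V F, IsTimelikeFamily L γ U V F ∧ FamilyContinuousAt L γ U V F

/-- The Fréchet distance is nonnegative. -/
lemma frechetDist_nonneg (γ σ : ℝ → X) : 0 ≤ frechetDist γ σ := by
  refine Real.sInf_nonneg ?_
  rintro r ⟨φ, ψ, -, -, h⟩
  exact dist_nonneg.trans (h 0 (by simp))

lemma dGamma_nonneg (L : LorentzianPreLengthSpace X) (γ σ : ℝ → X) : 0 ≤ dGamma L γ σ :=
  add_nonneg (frechetDist_nonneg γ σ) (abs_nonneg _)

lemma isParam_id : IsParam id :=
  ⟨continuousOn_id, strictMono_id.strictMonoOn _, image_id _⟩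

lemma dGamma_self (L : LorentzianPreLengthSpace X) (γ : ℝ → X) : dGamma L γ γ = 0 := by
  have h : frechetDist γ γ ≤ 0 := by
    refine csInf_le ⟨0, ?_⟩ ⟨id, id, isParam_id, isParam_id, by simp⟩
    rintro r ⟨φ, ψ, -, -, h⟩
    exact dist_nonneg.trans (h 0 (by simp))
  simp [dGamma, le_antisymm h (frechetDist_nonneg γ γ)]

/-- `σ` is a timelike geodesic from `p` to `q`. -/
def IsTGeoFromTo (L : LorentzianPreLengthSpace X) (p q : X) (σ : ℝ → X) : Prop :=
  InTGeo L σ ∧ σ 0 = p ∧ σ 1 = q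

lemma IsTGeoFromTo.chron {L : LorentzianPreLengthSpace X} {p q : X} {σ : ℝ → X}
    (h : IsTGeoFromTo L p q σ) : L.chron p q := by
  obtain ⟨⟨⟨-, -, h⟩, -⟩, rfl, rfl⟩ := h
  exact h 0 1 le_rfl one_pos le_rfl

/-- The sequential condition gives geodesics uniformly close to `γ` between all pairs of
points close to `p` and `q`. -/
lemma exists_close_tgeo_of_seq (L : LorentzianPreLengthSpace X) (γ : ℝ → X) (p q : X)
    (H : ∀ (ps qs : ℕ → X), Tendsto ps atTop (𝓝 p) → Tendsto qs atTop (𝓝 q) →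
      ∃ (i₀ : ℕ) (γs : ℕ → ℝ → X),
        (∀ i ≥ i₀, IsTGeoFromTo L (ps i) (qs i) (γs i)) ∧ DGammaTendsto L γs γ)
    {ε : ℝ} (hε : 0 < ε) :
    ∃ δ > 0, ∀ p' q', dist p' p < δ → dist q' q < δ →
      ∃ σ, IsTGeoFromTo L p' q' σ ∧ dGamma L σ γ < ε := by
  by_contra! hcon
  choose! ps qs hps hqs hσ using fun n : ℕ => hcon (1 / ((n : ℝ) + 1)) Nat.one_div_pos_of_nat
  have hlim {x : X} {u : ℕ → X} (hu : ∀ n : ℕ, dist (u n) x < 1 / ((n : ℝ) + 1)) :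
      Tendsto u atTop (𝓝 x) :=
    tendsto_iff_dist_tendsto_zero.2 <| squeeze_zero (fun _ => dist_nonneg)
      (fun n => (hu n).le) tendsto_one_div_add_atTop_nhds_zero_nat
  obtain ⟨i₀, γs, hγs, hconv⟩ := H ps qs (hlim hps) (hlim hqs)
  obtain ⟨n, hn, hge⟩ := ((hconv.eventually (gt_mem_nhds hε)).and (eventually_ge_atTop i₀)).exists
  exact (hσ n _ (hγs n hge)).not_gt hn

/-- If geodesics close to `γ` exist between all pairs of points close to the endpoints of `γ`,
then choosing almost optimal ones gives a timelike family continuous at `γ`. -/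
lemma embeddable_of_exists_close_tgeo (L : LorentzianPreLengthSpace X) {γ : ℝ → X}
    (hγ : InTGeo L γ)
    (H : ∀ ε > (0 : ℝ), ∃ δ > (0 : ℝ), ∀ p' q', dist p' (γ 0) < δ → dist q' (γ 1) < δ →
      ∃ σ, IsTGeoFromTo L p' q' σ ∧ dGamma L σ γ < ε) :
    Embeddable L γ := by
  obtain ⟨δ₀, hδ₀, h₀⟩ := H 1 one_pos
  let I : X → X → ℝ := fun p' q' => sInf ((fun σ => dGamma L σ γ) '' {σ | IsTGeoFromTo L p' q' σ})
  have hI {p' q' : X} {σ : ℝ → X} (hσ : IsTGeoFromTo L p' q' σ) : I p' q' ≤ dGamma L σ γ := by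
    refine csInf_le ⟨0, ?_⟩ ⟨σ, hσ, rfl⟩
    rintro _ ⟨σ, -, rfl⟩
    exact dGamma_nonneg L σ γ
  have key (p' q' : X) : ∃ σ : ℝ → X, (p' = γ 0 → q' = γ 1 → σ = γ) ∧
      (dist p' (γ 0) < δ₀ → dist q' (γ 1) < δ₀ → IsTGeoFromTo L p' q' σ ∧
        dGamma L σ γ ≤ I p' q' + (dist p' (γ 0) + dist q' (γ 1))) := by
    by_cases hpq : p' = γ 0 ∧ q' = γ 1
    · obtain ⟨rfl, rfl⟩ := hpq
      refine ⟨γ, fun _ _ => rfl, fun _ _ => ⟨⟨hγ, rfl, rfl⟩, ?_⟩⟩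
      simp only [dGamma_self, dist_self, add_zero]
      refine Real.sInf_nonneg ?_
      rintro _ ⟨σ, -, rfl⟩
      exact dGamma_nonneg L σ γ
    have hpos : 0 < dist p' (γ 0) + dist q' (γ 1) := by
      by_cases hp : p' = γ 0
      · exact add_pos_of_nonneg_of_pos dist_nonneg (dist_pos.2 fun hq => hpq ⟨hp, hq⟩)
      · exact add_pos_of_pos_of_nonneg (dist_pos.2 hp) dist_nonneg
    by_cases hne : ∃ σ, IsTGeoFromTo L p' q' σ
    · obtain ⟨σ₀, hσ₀⟩ := hne
      obtain ⟨_, ⟨σ, hσ, rfl⟩, hlt⟩ := exists_lt_of_csInf_lt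
        (Set.Nonempty.image _ ⟨σ₀, hσ₀⟩) (lt_add_of_pos_right (I p' q') hpos)
      exact ⟨σ, fun hp hq => (hpq ⟨hp, hq⟩).elim, fun _ _ => ⟨hσ, hlt.le⟩⟩
    · refine ⟨γ, fun _ _ => rfl, fun hp hq => ?_⟩
      obtain ⟨σ, hσ, -⟩ := h₀ p' q' hp hq
      exact (hne ⟨σ, hσ⟩).elim
  choose F hFγ hF using key
  refine ⟨Metric.ball (γ 0) δ₀, Metric.ball (γ 1) δ₀, F,
    ⟨Metric.ball_mem_nhds _ hδ₀, Metric.ball_mem_nhds _ hδ₀,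
      fun p' hp q' hq => (hF p' q' hp hq).1.chron, fun p' hp q' hq => (hF p' q' hp hq).1, ?_⟩, ?_⟩
  · rw [hFγ _ _ rfl rfl]
    exact ⟨id, isParam_id, fun _ _ => rfl⟩
  · intro ε hε
    obtain ⟨δ, hδ, h⟩ := H (ε / 2) (half_pos hε)
    refine ⟨min δ (ε / 4), lt_min hδ (by linarith), fun p' hpU q' hqV hp hq => ?_⟩
    obtain ⟨hp₁, hp₂⟩ := lt_min_iff.1 hp
    obtain ⟨hq₁, hq₂⟩ := lt_min_iff.1 hq
    obtain ⟨σ, hσ, hlt⟩ := h p' q' hp₁ hq₁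
    linarith [(hF p' q' hpU hqV).2, hI hσ]

/-- `γ ∈ TGeo(X)` is embeddable if and only if for all sequences
`pᵢ → γ(0)` and `qᵢ → γ(1)` there eventually exist timelike geodesics `γᵢ` from `pᵢ`
to `qᵢ` with `γᵢ → γ` with respect to `d_Γ`. -/
theorem embeddable_iff_geodesics_converge
    {X : Type*} [MetricSpace X] (L : LorentzianPreLengthSpace X)
    (hfin : FinitelyTauMeasurable L)
    (γ : ℝ → X) (hγ : InTGeo L γ) (p q : X) (hp : γ 0 = p) (hq : γ 1 = q) :
    Embeddable L γ ↔
      ∀ (ps qs : ℕ → X), Tendsto ps atTop (𝓝 p) → Tendsto qs atTop (𝓝 q) →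
        ∃ (i₀ : ℕ) (γs : ℕ → ℝ → X),
          (∀ i ≥ i₀, InTGeo L (γs i) ∧ γs i 0 = ps i ∧ γs i 1 = qs i) ∧
          DGammaTendsto L γs γ := by
  subst hp hq
  refine ⟨?_, fun H => embeddable_of_exists_close_tgeo L hγ fun ε hε =>
    exists_close_tgeo_of_seq L γ _ _ H hε⟩
  rintro ⟨U, V, F, ⟨hU, hV, -, hF, -⟩, hcont⟩ ps qs hps hqs
  have hmem := (hps.eventually hU).and (hqs.eventually hV)
  obtain ⟨i₀, hi₀⟩ := eventually_atTop.1 hmem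
  refine ⟨i₀, fun i => F (ps i) (qs i), fun i hi => hF _ (hi₀ i hi).1 _ (hi₀ i hi).2, ?_⟩
  refine Metric.tendsto_nhds.2 fun ε hε => ?_
  obtain ⟨δ, hδ, h⟩ := hcont ε hε
  filter_upwards [hmem, Metric.tendsto_nhds.1 hps δ hδ, Metric.tendsto_nhds.1 hqs δ hδ]
    with i hi hp hq
  rw [Real.dist_0_eq_abs, abs_of_nonneg (dGamma_nonneg L _ γ)]
  exact h _ hi.1 _ hi.2 hp hq

end
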